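/- Let P be a d-dimensional polytope and let Q ⊂ ℝ^{d+1} be a (d+1)-dimensional polytope with π_d(Q) = P whose number of facets equals the extension complexity xc(P) (a minimal (d+1)-extension of P). Then Q has at least two upper facets and at least two lower facets. -/

import Mathlib

open Set

noncomputable section

/-- A polytope: the convex hull of a finite set of points. -/
def IsPolytope {N : ℕ} (P : Set (Fin N → ℝ)) : Prop :=
  ∃ S : Finset (Fin N → ℝ), P = convexHull ℝ (S : Set (Fin N → ℝ))

/-- Dimension of a set: the dimension of its affine hull (with `-1` for the empty set). -/
def pdim {N : ℕ} (P : Set (Fin N → ℝ)) : ℤ :=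
  haveI := Classical.dec P.Nonempty
  if P.Nonempty then (Module.finrank ℝ (affineSpan ℝ P).direction : ℤ) else -1

/-- `F` is a face of `P`: the subset of `P` where some linear functional bounded above on `P`
attains its maximum value.  This includes `∅` and `P` itself. -/
def IsFaceOf {N : ℕ} (F P : Set (Fin N → ℝ)) : Prop :=
  ∃ (c : Fin N → ℝ) (b : ℝ),
    (∀ x ∈ P, ∑ i, c i * x i ≤ b) ∧ F = {x ∈ P | ∑ i, c i * x i = b}

/-- A facet: a face of dimension one less than the polytope. -/
def IsFacetOf {N : ℕ} (F P : Set (Fin N → ℝ)) : Prop :=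
  IsFaceOf F P ∧ pdim F + 1 = pdim P

/-- A ridge: a face of dimension two less than the polytope. -/
def IsRidgeOf {N : ℕ} (F P : Set (Fin N → ℝ)) : Prop :=
  IsFaceOf F P ∧ pdim F + 2 = pdim P

def IsVertexOf {N : ℕ} (v : Fin N → ℝ) (P : Set (Fin N → ℝ)) : Prop :=
  IsFaceOf {v} P

def vertexSet {N : ℕ} (P : Set (Fin N → ℝ)) : Set (Fin N → ℝ) :=
  {v | IsVertexOf v P}

def vertexCount {N : ℕ} (P : Set (Fin N → ℝ)) : ℕ := (vertexSet P).ncard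

def facetCount {N : ℕ} (P : Set (Fin N → ℝ)) : ℕ := {F | IsFacetOf F P}.ncard

/-- Extension complexity: the minimal number of facets of a polytope (in any dimension)
admitting an affine projection onto `P`. -/
def xc {N : ℕ} (P : Set (Fin N → ℝ)) : ℕ :=
  sInf {n | ∃ (e : ℕ) (Q : Set (Fin e → ℝ)) (π : (Fin e → ℝ) →ᵃ[ℝ] (Fin N → ℝ)),
    IsPolytope Q ∧ π '' Q = P ∧ facetCount Q = n}

/-- Combinatorial equivalence: an inclusion-preserving bijection between face lattices. -/
def CombEquiv {M N : ℕ} (P : Set (Fin M → ℝ)) (Q : Set (Fin N → ℝ)) : Prop :=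
  ∃ φ : {F : Set (Fin M → ℝ) // IsFaceOf F P} ≃ {G : Set (Fin N → ℝ) // IsFaceOf G Q},
    ∀ F₁ F₂ : {F : Set (Fin M → ℝ) // IsFaceOf F P},
      F₁.1 ⊆ F₂.1 ↔ (φ F₁).1 ⊆ (φ F₂).1

/-- A full-dimensional `n`-simplex in `ℝ^n` with the origin in its (relative) interior. -/
def simplexF (n : ℕ) : Set (Fin n → ℝ) :=
  convexHull ℝ ((Set.range fun i : Fin n => Pi.single i (1 : ℝ)) ∪ {fun _ => -1})

/-- The Cartesian product `Δ_n × Δ_m`, realized in `ℝ^{n+m}`. -/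
def prodP (n m : ℕ) : Set (Fin (n + m) → ℝ) :=
  {z | ∃ a ∈ simplexF n, ∃ b ∈ simplexF m, z = Fin.append a b}

/-- The direct sum `Δ_n ⊕ Δ_m`, realized in `ℝ^{n+m}`. -/
def sumP (n m : ℕ) : Set (Fin (n + m) → ℝ) :=
  convexHull ℝ (((fun a : Fin n → ℝ => Fin.append a (0 : Fin m → ℝ)) '' simplexF n) ∪
    ((fun b : Fin m → ℝ => Fin.append (0 : Fin n → ℝ) b) '' simplexF m))

/-- The join `A ⋆ B` of two polytopes, realized in `ℝ^{p+q+1}` with the two copies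
placed in skew affine subspaces. -/
def joinP {p q : ℕ} (A : Set (Fin p → ℝ)) (B : Set (Fin q → ℝ)) :
    Set (Fin (p + q + 1) → ℝ) :=
  convexHull ℝ
    (((fun a : Fin p → ℝ =>
        Fin.append (Fin.append a (0 : Fin q → ℝ)) (fun _ : Fin 1 => (0 : ℝ))) '' A) ∪
     ((fun b : Fin q → ℝ =>
        Fin.append (Fin.append (0 : Fin p → ℝ) b) (fun _ : Fin 1 => (1 : ℝ))) '' B))

/-- The canonical `k`-fold iterated pyramid over `X`, realized in `ℝ^{p+k}`. -/
def pyrK {p : ℕ} (k : ℕ) (X : Set (Fin p → ℝ)) : Set (Fin (p + k) → ℝ) :=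
  convexHull ℝ (((fun x : Fin p → ℝ => Fin.append x (0 : Fin k → ℝ)) '' X) ∪
    Set.range (fun j : Fin k => Fin.append (0 : Fin p → ℝ) (Pi.single j (1 : ℝ))))

/-- Transport a subset of `ℝ^a` to `ℝ^b` along a proof that `a = b`. -/
def castSet {a b : ℕ} (h : a = b) (X : Set (Fin a → ℝ)) : Set (Fin b → ℝ) :=
  (fun x : Fin a → ℝ => fun i : Fin b => x (Fin.cast h.symm i)) '' X

/-- Projective equivalence of two subsets of `ℝ^N`: `Q` is the image of `P` under a
projective transformation `x ↦ (A x + b) / (⟨c, x⟩ + δ)` whose associated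
`(N+1) × (N+1)` matrix is invertible and whose denominator is positive on `P`. -/
def ProjEquiv {N : ℕ} (P Q : Set (Fin N → ℝ)) : Prop :=
  ∃ (A : (Fin N → ℝ) →ₗ[ℝ] (Fin N → ℝ)) (b c : Fin N → ℝ) (δ : ℝ),
    Function.Bijective
      (fun z : (Fin N → ℝ) × ℝ => (A z.1 + z.2 • b, (∑ i, c i * z.1 i) + δ * z.2)) ∧
    (∀ x ∈ P, 0 < (∑ i, c i * x i) + δ) ∧
    Q = (fun x : Fin N → ℝ => ((∑ i, c i * x i) + δ)⁻¹ • (A x + b)) '' P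

/-- `P` is a pyramid with base `B`: the convex hull of `B` and a point outside
the affine hull of `B`. -/
def IsPyramidOver {N : ℕ} (P B : Set (Fin N → ℝ)) : Prop :=
  ∃ a : Fin N → ℝ, a ∉ affineSpan ℝ B ∧ P = convexHull ℝ (B ∪ {a})

/-- `P` is a `k`-fold iterated pyramid over `B`. -/
def IsKFoldPyramidOver {N : ℕ} : ℕ → Set (Fin N → ℝ) → Set (Fin N → ℝ) → Prop
  | 0, P, B => P = B
  | k + 1, P, B => ∃ P' : Set (Fin N → ℝ), IsPyramidOver P P' ∧ IsKFoldPyramidOver k P' B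

/-- `P` is a pyramid: the convex hull of one of its facets together with one more vertex. -/
def IsPyramidPolytope {N : ℕ} (P : Set (Fin N → ℝ)) : Prop :=
  ∃ (F : Set (Fin N → ℝ)) (v : Fin N → ℝ),
    IsFacetOf F P ∧ IsVertexOf v P ∧ P = convexHull ℝ (F ∪ {v})

/-- A facet is pyramidal if it contains all vertices of the polytope but one. -/
def IsPyramidalFacet {N : ℕ} (F P : Set (Fin N → ℝ)) : Prop :=
  IsFacetOf F P ∧ ∃ v, IsVertexOf v P ∧ v ∉ F ∧ ∀ w, IsVertexOf w P → w ≠ v → w ∈ F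

/-- The projection `π_d : ℝ^{d+1} → ℝ^d` forgetting the last coordinate. -/
def projFun (d : ℕ) : (Fin (d + 1) → ℝ) → (Fin d → ℝ) :=
  fun x i => x i.castSucc

/-- `c` is an outer normal vector exposing the face `F` of `Q`. -/
def IsOuterNormal {N : ℕ} (Q F : Set (Fin N → ℝ)) (c : Fin N → ℝ) : Prop :=
  ∃ b : ℝ, (∀ x ∈ Q, ∑ i, c i * x i ≤ b) ∧ F = {x ∈ Q | ∑ i, c i * x i = b}

/-- An upper facet: outer normal with positive last coordinate. -/
def IsUpperFacet {d : ℕ} (F Q : Set (Fin (d + 1) → ℝ)) : Prop :=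
  IsFacetOf F Q ∧ ∃ c, IsOuterNormal Q F c ∧ 0 < c (Fin.last d)

/-- A lower facet: outer normal with negative last coordinate. -/
def IsLowerFacet {d : ℕ} (F Q : Set (Fin (d + 1) → ℝ)) : Prop :=
  IsFacetOf F Q ∧ ∃ c, IsOuterNormal Q F c ∧ c (Fin.last d) < 0

/-- A vertical facet: every outer normal has vanishing last coordinate. -/
def IsVerticalFacet {d : ℕ} (F Q : Set (Fin (d + 1) → ℝ)) : Prop :=
  IsFacetOf F Q ∧ ∀ c, IsOuterNormal Q F c → c (Fin.last d) = 0

/-- An equatorial ridge: a ridge that is the intersection of an upper and a lower facet. -/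
def IsEquatorialRidge {d : ℕ} (F Q : Set (Fin (d + 1) → ℝ)) : Prop :=
  IsRidgeOf F Q ∧ ∃ F₁ F₂ : Set (Fin (d + 1) → ℝ),
    IsUpperFacet F₁ Q ∧ IsLowerFacet F₂ Q ∧ F = F₁ ∩ F₂

/-- A face `F` of `Q` is preserved under the projection forgetting the last coordinate. -/
def PreservedFace {d : ℕ} (Q F : Set (Fin (d + 1) → ℝ)) : Prop :=
  IsFaceOf (projFun d '' F) (projFun d '' Q) ∧ projFun d ⁻¹' (projFun d '' F) ∩ Q = F

/-- A face `F` of `Q` is strictly preserved: preserved and of the same dimension as its image. -/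
def StrictlyPreservedFace {d : ℕ} (Q F : Set (Fin (d + 1) → ℝ)) : Prop :=
  PreservedFace Q F ∧ pdim (projFun d '' F) = pdim F

/-- A hexagon: a 2-dimensional polytope with exactly 6 vertices. -/
def IsHexagon {N : ℕ} (P : Set (Fin N → ℝ)) : Prop :=
  IsPolytope P ∧ pdim P = 2 ∧ vertexCount P = 6

/-- Three lines are concurrent: they share a common point, or they are pairwise parallel. -/
def ConcurrentLines {N : ℕ} (L₁ L₂ L₃ : AffineSubspace ℝ (Fin N → ℝ)) : Prop :=
  (∃ x, x ∈ L₁ ∧ x ∈ L₂ ∧ x ∈ L₃) ∨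
    (AffineSubspace.Parallel L₁ L₂ ∧ AffineSubspace.Parallel L₂ L₃ ∧
      AffineSubspace.Parallel L₁ L₃)

/-- A cyclic labeling of the vertices of a hexagon: consecutive points are joined by edges. -/
def CyclicLabeling {N : ℕ} (P : Set (Fin N → ℝ)) (p : Fin 6 → (Fin N → ℝ)) : Prop :=
  Function.Injective p ∧ Set.range p = vertexSet P ∧
    ∀ i : Fin 6, IsFaceOf (segment ℝ (p i) (p (i + 1))) P

/-- A Desarguian hexagon. -/
def Desarguian {N : ℕ} (P : Set (Fin N → ℝ)) : Prop :=
  ∃ p : Fin 6 → (Fin N → ℝ), CyclicLabeling P p ∧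
    ConcurrentLines (affineSpan ℝ {p 0, p 1}) (affineSpan ℝ {p 5, p 2})
      (affineSpan ℝ {p 3, p 4})

/-- A polytope is simplicial if every facet is a simplex. -/
def IsSimplicial {N : ℕ} (P : Set (Fin N → ℝ)) : Prop :=
  ∀ F : Set (Fin N → ℝ), IsFacetOf F P →
    ∃ S : Finset (Fin N → ℝ),
      AffineIndependent ℝ (Subtype.val : {x // x ∈ S} → (Fin N → ℝ)) ∧
      F = convexHull ℝ (S : Set (Fin N → ℝ))

section ExtremalInduction

variable {ι W : Type*} [Fintype ι] [AddCommGroup W] [Module ℝ W]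

/-- An element spanning an extreme ray of the cone `{f | ∀ i, 0 ≤ ev i f}`: it is nonzero and
determined up to scaling by the inequalities that it satisfies with equality. -/
def IsExtremal (ev : ι → W →ₗ[ℝ] ℝ) (g : W) : Prop :=
  (∀ i, 0 ≤ ev i g) ∧ g ≠ 0 ∧
    ∀ k, (∀ i, ev i g = 0 → ev i k = 0) → ∃ t : ℝ, k = t • g

/-- An element of a pointed polyhedral cone is a sum of extremal elements which vanish wherever
it vanishes. -/
theorem IsExtremal.induction (ev : ι → W →ₗ[ℝ] ℝ) (hinj : ∀ f, (∀ i, ev i f = 0) → f = 0)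
    (p : W → Prop) (h0 : p 0) (hadd : ∀ f g, p f → p g → p (f + g)) (f : W)
    (hf : ∀ i, 0 ≤ ev i f)
    (hext : ∀ g, IsExtremal ev g → (∀ i, ev i f = 0 → ev i g = 0) → p g) : p f := by
  classical
  induction hn : (Finset.univ.filter fun i => ev i f ≠ 0).card using Nat.strong_induction_on
    generalizing f with
  | _ n ih =>
  by_cases hf0 : f = 0
  · exact hf0 ▸ h0
  by_cases hfe : IsExtremal ev f
  · exact hext f hfe fun _ h => h
  have descend : ∀ g, (∀ i, 0 ≤ ev i g) → (∀ i, ev i f = 0 → ev i g = 0) →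
      (∃ i, ev i f ≠ 0 ∧ ev i g = 0) → p g := by
    rintro g hg hfg ⟨i, hif, hig⟩
    refine ih _ ?_ g hg (fun k hk hgk => hext k hk fun j hj => hgk j (hfg j hj)) rfl
    rw [← hn]
    apply Finset.card_lt_card
    refine Finset.ssubset_iff_subset_ne.2 ⟨fun j hj => ?_, fun h => ?_⟩
    · simp only [Finset.mem_filter, Finset.mem_univ, true_and] at hj ⊢
      exact fun h => hj (hfg j h)
    · have : i ∈ Finset.univ.filter fun i => ev i f ≠ 0 := by simpa using hif
      rw [← h] at this
      simp [hig] at this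
  have exists_min : ∀ g k : W, (∀ i, 0 ≤ ev i g) → g ≠ 0 →
      ∃ i, ev i g ≠ 0 ∧ ∀ j, ev j g ≠ 0 → 0 ≤ ev j (k - (ev i k / ev i g) • g) := by
    intro g k hg hg0
    have hne : (Finset.univ.filter fun i => ev i g ≠ 0).Nonempty := by
      by_contra h
      rw [Finset.not_nonempty_iff_eq_empty, Finset.filter_eq_empty_iff] at h
      exact hg0 (hinj g fun i => not_not.1 (h (Finset.mem_univ i)))
    obtain ⟨i, hi, him⟩ := Finset.exists_min_image _ (fun i => ev i k / ev i g) hne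
    refine ⟨i, by simpa using hi, fun j hj => ?_⟩
    have hjp : 0 < ev j g := lt_of_le_of_ne (hg j) hj.symm
    have := him j (by simpa using hj)
    rw [le_div_iff₀ hjp] at this
    simpa using this
  obtain ⟨k, hk, hkf⟩ : ∃ k, (∀ i, ev i f = 0 → ev i k = 0) ∧ ∀ t : ℝ, k ≠ t • f := by
    by_contra! h
    exact hfe ⟨hf, hf0, h⟩
  obtain ⟨i, hi, himin⟩ := exists_min f k hf hf0
  obtain ⟨g, hgdef⟩ : ∃ g, g = k - (ev i k / ev i f) • f := ⟨_, rfl⟩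
  rw [← hgdef] at himin
  have hfg : ∀ j, ev j f = 0 → ev j g = 0 := fun j hj => by simp [hgdef, hj, hk j hj]
  have hg : ∀ j, 0 ≤ ev j g := fun j => by
    by_cases hj : ev j f = 0
    · exact (hfg j hj).ge
    · exact himin j hj
  have hgi : ev i g = 0 := by simp [hgdef, hi]
  have hg0 : g ≠ 0 := fun h => hkf _ (sub_eq_zero.1 (hgdef ▸ h))
  obtain ⟨j, hj, hjmin⟩ := exists_min g f hg hg0
  have ht : 0 ≤ ev j f / ev j g := div_nonneg (hf j) (hg j)
  have h1 : p ((ev j f / ev j g) • g) := by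
    refine descend _ (fun l => ?_) (fun l hl => by simp [hfg l hl]) ⟨i, hi, by simp [hgi]⟩
    simpa using mul_nonneg ht (hg l)
  have h2 : p (f - (ev j f / ev j g) • g) := by
    refine descend _ (fun l => ?_) (fun l hl => by simp [hl, hfg l hl])
      ⟨j, fun h => hj (hfg j h), by simp [hj]⟩
    by_cases hl : ev l g = 0
    · simpa [hl] using hf l
    · exact hjmin l hl
  have := hadd _ _ h1 h2
  rwa [add_sub_cancel] at this

end ExtremalInduction

/-- The affine function `x ↦ b - ⟨c, x⟩`, evaluated at `x` and linear in `(c, b)`. -/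
def slack {N : ℕ} (x : Fin N → ℝ) : ((Fin N → ℝ) × ℝ) →ₗ[ℝ] ℝ where
  toFun f := f.2 - ∑ i, f.1 i * x i
  map_add' f g := by
    simp only [Prod.snd_add, Prod.fst_add, Pi.add_apply, add_mul, Finset.sum_add_distrib]
    ring
  map_smul' t f := by
    simp only [Prod.smul_snd, Prod.smul_fst, Pi.smul_apply, smul_eq_mul, mul_assoc,
      RingHom.id_apply, ← Finset.mul_sum]
    ring

theorem slack_apply {N : ℕ} (x : Fin N → ℝ) (f : (Fin N → ℝ) × ℝ) :
    slack x f = f.2 - ∑ i, f.1 i * x i := rfl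

theorem isFaceOf_iff_slack {N : ℕ} {F P : Set (Fin N → ℝ)} :
    IsFaceOf F P ↔ ∃ f, (∀ x ∈ P, 0 ≤ slack x f) ∧ F = {x ∈ P | slack x f = 0} := by
  simp only [IsFaceOf, Prod.exists, slack_apply, sub_nonneg, sub_eq_zero,
    eq_comm (b := Finset.sum _ _)]

theorem isOuterNormal_iff_slack {N : ℕ} {F P : Set (Fin N → ℝ)} {c : Fin N → ℝ} :
    IsOuterNormal P F c ↔
      ∃ b, (∀ x ∈ P, 0 ≤ slack x (c, b)) ∧ F = {x ∈ P | slack x (c, b) = 0} := by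
  simp only [IsOuterNormal, slack_apply, sub_nonneg, sub_eq_zero, eq_comm (b := Finset.sum _ _)]

theorem slack_sum_smul {N : ℕ} (S : Finset (Fin N → ℝ)) (w : (Fin N → ℝ) → ℝ)
    (hw : ∑ y ∈ S, w y = 1) (f : (Fin N → ℝ) × ℝ) :
    slack (∑ y ∈ S, w y • y) f = ∑ y ∈ S, w y * slack y f := by
  simp only [slack_apply, mul_sub, Finset.sum_sub_distrib, ← Finset.sum_mul, hw, one_mul,
    Finset.sum_apply, Pi.smul_apply, smul_eq_mul, Finset.mul_sum]
  rw [Finset.sum_comm]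
  simp only [mul_left_comm]

theorem slack_nonneg_of_mem_convexHull {N : ℕ} {S : Finset (Fin N → ℝ)} {f : (Fin N → ℝ) × ℝ}
    (h : ∀ y ∈ S, 0 ≤ slack y f) {x : Fin N → ℝ} (hx : x ∈ convexHull ℝ (S : Set (Fin N → ℝ))) :
    0 ≤ slack x f := by
  obtain ⟨w, hw, hw1, rfl⟩ := Finset.mem_convexHull'.1 hx
  rw [slack_sum_smul S w hw1]
  exact Finset.sum_nonneg fun y hy => mul_nonneg (hw y hy) (h y hy)

theorem slack_eq_zero_of_mem_convexHull {N : ℕ} {S : Finset (Fin N → ℝ)}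
    {f g : (Fin N → ℝ) × ℝ} (hf : ∀ y ∈ S, 0 ≤ slack y f)
    (hfg : ∀ y ∈ S, slack y f = 0 → slack y g = 0) {x : Fin N → ℝ}
    (hx : x ∈ convexHull ℝ (S : Set (Fin N → ℝ))) (hxf : slack x f = 0) : slack x g = 0 := by
  obtain ⟨w, hw, hw1, rfl⟩ := Finset.mem_convexHull'.1 hx
  rw [slack_sum_smul S w hw1] at hxf ⊢
  rw [Finset.sum_eq_zero_iff_of_nonneg fun y hy => mul_nonneg (hw y hy) (hf y hy)] at hxf
  refine Finset.sum_eq_zero fun y hy => ?_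
  rcases mul_eq_zero.1 (hxf y hy) with h | h
  · rw [h, zero_mul]
  · rw [hfg y hy h, mul_zero]

theorem mem_convexHull_of_slack_nonneg {N : ℕ} {S : Finset (Fin N → ℝ)} {y : Fin N → ℝ}
    (h : ∀ f, (∀ x ∈ S, 0 ≤ slack x f) → 0 ≤ slack y f) :
    y ∈ convexHull ℝ (S : Set (Fin N → ℝ)) := by
  by_contra hy
  obtain ⟨φ, u, hu, huy⟩ := geometric_hahn_banach_closed_point (convex_convexHull ℝ _)
    (S.finite_toSet.isClosed_convexHull (𝕜 := ℝ)) hy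
  have hs : ∀ x, slack x ((dotProductEquiv ℝ (Fin N)).symm φ.toLinearMap, u) = u - φ x := by
    intro x
    have : dotProductEquiv ℝ (Fin N) ((dotProductEquiv ℝ (Fin N)).symm φ.toLinearMap) x = φ x := by
      rw [LinearEquiv.apply_symm_apply]; rfl
    rw [slack_apply, ← this]; rfl
  have := h ((dotProductEquiv ℝ (Fin N)).symm φ.toLinearMap, u) fun x hx => by
    rw [hs]
    exact sub_nonneg.2 (hu x (subset_convexHull ℝ _ hx)).le
  rw [hs] at this
  linarith

/-- The affine functions vanishing on `F`. -/
def vanishing {N : ℕ} (F : Set (Fin N → ℝ)) : Submodule ℝ ((Fin N → ℝ) × ℝ) :=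
  ⨅ x ∈ F, LinearMap.ker (slack x)

theorem mem_vanishing {N : ℕ} {F : Set (Fin N → ℝ)} {f : (Fin N → ℝ) × ℝ} :
    f ∈ vanishing F ↔ ∀ x ∈ F, slack x f = 0 := by
  simp [vanishing]

theorem finrank_vanishing {N : ℕ} (F : Set (Fin N → ℝ)) :
    (Module.finrank ℝ (vanishing F) : ℤ) = N - pdim F := by
  rcases F.eq_empty_or_nonempty with rfl | ⟨p, hp⟩
  · have : vanishing (∅ : Set (Fin N → ℝ)) = ⊤ := by simp [vanishing]
    rw [this, finrank_top]
    simp [pdim]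
  have hne : F.Nonempty := ⟨p, hp⟩
  let φ : vanishing F →ₗ[ℝ] Module.Dual ℝ (Fin N → ℝ) :=
    (dotProductEquiv ℝ (Fin N)).toLinearMap ∘ₗ LinearMap.fst ℝ _ _ ∘ₗ (vanishing F).subtype
  have hφ : ∀ f x, φ f x = ∑ i, f.1.1 i * x i := fun f x => rfl
  have hinj : Function.Injective φ := by
    rw [← LinearMap.ker_eq_bot, LinearMap.ker_eq_bot']
    rintro ⟨⟨c, b⟩, hf⟩ h
    have hc : c = 0 := (dotProductEquiv ℝ (Fin N)).map_eq_zero_iff.1 h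
    have := mem_vanishing.1 hf p hp
    simp [slack_apply, hc] at this
    simp [hc, this]
  have hrange : LinearMap.range φ = (affineSpan ℝ F).direction.dualAnnihilator := by
    rw [direction_affineSpan, vectorSpan_eq_span_vsub_set_right ℝ hp]
    ext ψ
    simp only [LinearMap.mem_range, Submodule.mem_dualAnnihilator]
    constructor
    · rintro ⟨f, rfl⟩ w hw
      refine Submodule.span_induction (p := fun w _ => φ f w = 0) ?_ (by simp)
        (fun x y _ _ hx hy => by rw [map_add, hx, hy, add_zero])
        (fun t x _ hx => by rw [map_smul, hx, smul_zero]) hw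
      rintro _ ⟨x, hx, rfl⟩
      have h1 := mem_vanishing.1 f.2 x hx
      have h2 := mem_vanishing.1 f.2 p hp
      rw [slack_apply] at h1 h2
      change φ f (x - p) = 0
      rw [map_sub, hφ, hφ]
      linarith
    · intro h
      have hs : ∀ x, ∑ i, (dotProductEquiv ℝ (Fin N)).symm ψ i * x i = ψ x := fun x =>
        LinearMap.congr_fun ((dotProductEquiv ℝ (Fin N)).apply_symm_apply ψ) x
      refine ⟨⟨((dotProductEquiv ℝ (Fin N)).symm ψ, ψ p), mem_vanishing.2 fun x hx => ?_⟩, ?_⟩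
      · have := h (x - p) (Submodule.subset_span ⟨x, hx, rfl⟩)
        rw [map_sub] at this
        rw [slack_apply, hs]
        linarith
      · ext x
        simp [φ]
  have h1 := LinearMap.finrank_range_of_inj hinj
  have h2 := Subspace.finrank_add_finrank_dualAnnihilator_eq (affineSpan ℝ F).direction
  rw [hrange] at h1
  rw [Module.finrank_fin_fun] at h2
  rw [pdim, if_pos hne]
  omega

theorem eq_zero_of_vanishing_of_pdim_eq {N : ℕ} {P : Set (Fin N → ℝ)} (hP : pdim P = N)
    {f : (Fin N → ℝ) × ℝ} (hf : ∀ x ∈ P, slack x f = 0) : f = 0 := by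
  have h := finrank_vanishing P
  rw [hP, sub_self] at h
  have : vanishing P = ⊥ := Submodule.finrank_eq_zero.1 (by exact_mod_cast h)
  exact (Submodule.mem_bot ℝ).1 (this ▸ mem_vanishing.2 hf)

/-- A facet of a full-dimensional set determines its defining affine function up to scaling. -/
theorem IsFacetOf.exists_slack {N : ℕ} {F P : Set (Fin N → ℝ)} (hP : pdim P = N)
    (hF : IsFacetOf F P) {f : (Fin N → ℝ) × ℝ} (hf : F = {x ∈ P | slack x f = 0}) :
    f ≠ 0 ∧ ∀ k, (∀ x ∈ F, slack x k = 0) → ∃ t : ℝ, k = t • f := by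
  have hd := hF.2
  have hf0 : f ≠ 0 := by
    rintro rfl
    have : F = P := by simp [hf]
    rw [this] at hd
    omega
  refine ⟨hf0, fun k hk => ?_⟩
  have h1 : Module.finrank ℝ (vanishing F) = 1 := by
    have := finrank_vanishing F
    omega
  have hfm : f ∈ vanishing F := mem_vanishing.2 fun x hx => by
    rw [hf] at hx; exact hx.2
  obtain ⟨t, ht⟩ := (finrank_eq_one_iff_of_nonzero' (⟨f, hfm⟩ : vanishing F)
    (by simpa using hf0)).1 h1 ⟨k, mem_vanishing.2 hk⟩
  exact ⟨t, (congrArg Subtype.val ht).symm⟩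

theorem pdim_of_vanishing_spanned {N : ℕ} {F : Set (Fin N → ℝ)} {f : (Fin N → ℝ) × ℝ}
    (hf0 : f ≠ 0) (hf : ∀ x ∈ F, slack x f = 0)
    (h : ∀ k, (∀ x ∈ F, slack x k = 0) → ∃ t : ℝ, k = t • f) : pdim F + 1 = N := by
  have h1 : Module.finrank ℝ (vanishing F) = 1 := by
    refine (finrank_eq_one_iff_of_nonzero' (⟨f, mem_vanishing.2 hf⟩ : vanishing F)
      (by simpa using hf0)).2 fun k => ?_
    obtain ⟨t, ht⟩ := h k (mem_vanishing.1 k.2)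
    exact ⟨t, Subtype.ext ht.symm⟩
  have := finrank_vanishing F
  omega

/-- A polytope has finitely many faces. -/
theorem IsPolytope.finite_faces {N : ℕ} {P : Set (Fin N → ℝ)} (hP : IsPolytope P) :
    {F | IsFaceOf F P}.Finite := by
  obtain ⟨S, rfl⟩ := hP
  refine Set.Finite.of_finite_image (f := fun F => F ∩ (S : Set (Fin N → ℝ)))
    (S.finite_toSet.finite_subsets.subset ?_) ?_
  · rintro _ ⟨F, -, rfl⟩
    exact Set.inter_subset_right
  · have key : ∀ F G, IsFaceOf F (convexHull ℝ (S : Set (Fin N → ℝ))) →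
        IsFaceOf G (convexHull ℝ (S : Set (Fin N → ℝ))) → F ∩ S = G ∩ S → F ⊆ G := by
      intro F G hF hG h
      obtain ⟨f, hf, rfl⟩ := isFaceOf_iff_slack.1 hF
      obtain ⟨g, hg, rfl⟩ := isFaceOf_iff_slack.1 hG
      have hS := subset_convexHull ℝ (S : Set (Fin N → ℝ))
      refine fun x hx => ⟨hx.1, slack_eq_zero_of_mem_convexHull (fun y hy => hf y (hS hy))
        (fun y hy hyf => ?_) hx.1 hx.2⟩
      have : y ∈ {x ∈ convexHull ℝ (S : Set (Fin N → ℝ)) | slack x f = 0} ∩ S :=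
        ⟨⟨hS hy, hyf⟩, hy⟩
      rw [h] at this
      exact this.1.2
    exact fun F hF G hG h => (key F G hF hG h).antisymm (key G F hG hF h.symm)

theorem IsExtremal.isFacetOf {N : ℕ} {S : Finset (Fin N → ℝ)}
    (hd : pdim (convexHull ℝ (S : Set (Fin N → ℝ))) = N) {g : (Fin N → ℝ) × ℝ}
    (hg : IsExtremal (fun s : S => slack s.1) g) :
    IsFacetOf {x ∈ convexHull ℝ (S : Set (Fin N → ℝ)) | slack x g = 0}
      (convexHull ℝ (S : Set (Fin N → ℝ))) := by
  refine ⟨isFaceOf_iff_slack.2 ⟨g, fun x hx => slack_nonneg_of_mem_convexHull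
    (fun y hy => hg.1 ⟨y, hy⟩) hx, rfl⟩, ?_⟩
  rw [hd]
  exact pdim_of_vanishing_spanned hg.2.1 (fun x hx => hx.2) fun k hk => hg.2.2 k fun i hi =>
    hk i.1 ⟨subset_convexHull ℝ _ i.2, hi⟩

/-- Functions on `ℝ^d` correspond to functions on `ℝ^{d+1}` not depending on the last
coordinate. -/
theorem slack_projFun {d : ℕ} (x : Fin (d + 1) → ℝ) {f : (Fin (d + 1) → ℝ) × ℝ}
    (hf : f.1 (Fin.last d) = 0) :
    slack (projFun d x) (fun i => f.1 i.castSucc, f.2) = slack x f := by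
  simp [slack_apply, Fin.sum_univ_castSucc, projFun, hf]

/-- Moving a point vertically does not change its projection, and changes affine functions in
proportion to their last coefficient. -/
theorem exists_vertical_translate {d : ℕ} (x : Fin (d + 1) → ℝ) (s : ℝ) :
    ∃ y : Fin (d + 1) → ℝ, projFun d y = projFun d x ∧
      ∀ f : (Fin (d + 1) → ℝ) × ℝ, slack y f = slack x f - s * f.1 (Fin.last d) := by
  refine ⟨Fin.snoc (α := fun _ => ℝ) (projFun d x) (x (Fin.last d) + s), ?_, fun f => ?_⟩
  · funext i
    simp [projFun]
  · simp only [slack_apply, Fin.sum_univ_castSucc, Fin.snoc_castSucc, Fin.snoc_last, projFun]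
    ring

/-- If a full-dimensional polytope in `ℝ^{d+1}` has at most one facet with outer normal pointing
in the direction `σ` (up or down), then it has more facets than its projection to `ℝ^d`. -/
theorem two_le_ncard_of_facetCount_le {d : ℕ} {Q : Set (Fin (d + 1) → ℝ)} (hQ : IsPolytope Q)
    (hdQ : pdim Q = d + 1) (hdP : pdim (projFun d '' Q) = d)
    (hle : facetCount Q ≤ facetCount (projFun d '' Q)) {σ : ℝ} (hσ : σ ≠ 0) :
    2 ≤ {F | IsFacetOf F Q ∧ ∃ c, IsOuterNormal Q F c ∧ 0 < σ * c (Fin.last d)}.ncard := by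
  have hfin : {F | IsFacetOf F Q}.Finite := hQ.finite_faces.subset fun F hF => hF.1
  obtain ⟨S, rfl⟩ := hQ
  set Q := convexHull ℝ (S : Set (Fin (d + 1) → ℝ)) with hQdef
  have hdQ' : pdim Q = ((d + 1 : ℕ) : ℤ) := by rw [hdQ]; norm_cast
  have hSQ : (S : Set (Fin (d + 1) → ℝ)) ⊆ Q := subset_convexHull ℝ _
  have hinj : ∀ f, (∀ i : S, slack i.1 f = 0) → f = 0 := fun f hf =>
    eq_zero_of_vanishing_of_pdim_eq hdQ' fun x hx =>
      slack_eq_zero_of_mem_convexHull (f := 0) (by simp) (fun y hy _ => hf ⟨y, hy⟩) hx (by simp)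
  have hind := IsExtremal.induction (fun s : S => slack s.1) hinj
  have hσ2 : 0 < σ * σ := mul_self_pos.2 hσ
  obtain ⟨u, hu, huσ⟩ : ∃ u, IsExtremal (fun s : S => slack s.1) u ∧
      0 < σ * u.1 (Fin.last d) := by
    by_contra! h
    obtain ⟨b, hb⟩ := (S.image fun x => σ * x (Fin.last d)).exists_le
    have := hind (fun f => σ * f.1 (Fin.last d) ≤ 0) (by simp)
      (fun f g hf hg => by simpa [mul_add] using add_nonpos hf hg)
      (Pi.single (Fin.last d) σ, b) (fun i => by
        have := hb _ (Finset.mem_image_of_mem _ i.2)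
        simpa [slack_apply, Pi.single_apply] using this) fun g hg _ => h g hg
    simp only [Pi.single_eq_same] at this
    linarith
  have hul : u.1 (Fin.last d) ≠ 0 := fun h => by simp [h] at huσ
  have hmem : ∀ g, IsExtremal (fun s : S => slack s.1) g → 0 < σ * g.1 (Fin.last d) →
      {x ∈ Q | slack x g = 0} ∈
        {F | IsFacetOf F Q ∧ ∃ c, IsOuterNormal Q F c ∧ 0 < σ * c (Fin.last d)} :=
    fun g hg hgσ => ⟨hg.isFacetOf hdQ', g.1, isOuterNormal_iff_slack.2 ⟨g.2, fun x hx =>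
      slack_nonneg_of_mem_convexHull (fun y hy => hg.1 ⟨y, hy⟩) hx, rfl⟩, hgσ⟩
  by_contra! hlt
  have hone := (Set.ncard_le_one (hfin.subset fun F hF => hF.1)).1 (Nat.lt_succ_iff.1 hlt)
  set U := {x ∈ Q | slack x u = 0} with hU
  have hUfac : IsFacetOf U Q := hu.isFacetOf hdQ'
  have hUspan := (hUfac.exists_slack hdQ' hU).2
  have huniq : ∀ g, IsExtremal (fun s : S => slack s.1) g → 0 < σ * g.1 (Fin.last d) →
      ∃ t : ℝ, g = t • u := fun g hg hgσ => hUspan g fun x hx => by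
    rw [hU, hone _ (hmem u hu huσ) _ (hmem g hg hgσ)] at hx
    exact hx.2
  have hlift : ∀ x ∈ Q, ∃ y ∈ U, projFun d y = projFun d x := by
    intro x hx
    have hxu : 0 ≤ slack x u := slack_nonneg_of_mem_convexHull (fun y hy => hu.1 ⟨y, hy⟩) hx
    obtain ⟨s, hsu⟩ : ∃ s, s * u.1 (Fin.last d) = slack x u := ⟨_, div_mul_cancel₀ _ hul⟩
    obtain ⟨y, hyx, hy⟩ := exists_vertical_translate x s
    have hsσ : 0 ≤ σ * s := by
      have : σ * s * (σ * u.1 (Fin.last d)) = (σ * σ) * slack x u := by rw [← hsu]; ring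
      exact nonneg_of_mul_nonneg_left (by rw [this]; exact mul_nonneg hσ2.le hxu) huσ
    have hyu : slack y u = 0 := by rw [hy, hsu, sub_self]
    refine ⟨y, ⟨mem_convexHull_of_slack_nonneg fun f hf => ?_, hyu⟩, hyx⟩
    refine hind (fun f => 0 ≤ slack y f) (by simp)
      (fun f g hf hg => by simpa using add_nonneg hf hg) f (fun i => hf i.1 i.2) fun g hg _ => ?_
    by_cases hgσ : 0 < σ * g.1 (Fin.last d)
    · obtain ⟨t, rfl⟩ := huniq g hg hgσ
      simp [hyu]
    · have hxg : 0 ≤ slack x g :=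
        slack_nonneg_of_mem_convexHull (fun y hy => hg.1 ⟨y, hy⟩) hx
      have h1 : (σ * σ) * (s * g.1 (Fin.last d)) ≤ 0 := by
        have := mul_nonpos_of_nonneg_of_nonpos hsσ (not_lt.1 hgσ)
        linarith
      have h2 := nonpos_of_mul_nonpos_right h1 hσ2
      rw [hy]
      linarith
  have hsub : {H | IsFacetOf H (projFun d '' Q)} ⊆
      (fun G => projFun d '' (G ∩ U)) '' ({F | IsFacetOf F Q} \ {U}) := by
    intro H hH
    obtain ⟨h, hhP, hhH⟩ := isFaceOf_iff_slack.1 hH.1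
    obtain ⟨hh0, hHspan⟩ := hH.exists_slack hdP hhH
    obtain ⟨h', hh'l, hh'⟩ : ∃ h' : (Fin (d + 1) → ℝ) × ℝ, h'.1 (Fin.last d) = 0 ∧
        h = (fun i => h'.1 i.castSucc, h'.2) :=
      ⟨(Fin.snoc (α := fun _ => ℝ) h.1 0, h.2), by simp, by simp⟩
    have hslack : ∀ x, slack (projFun d x) h = slack x h' := fun x => by
      rw [hh', slack_projFun x hh'l]
    have hh'0 : ∀ x ∈ Q, 0 ≤ slack x h' := fun x hx =>
      (hhP _ ⟨x, hx, rfl⟩).trans_eq (hslack x)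
    obtain ⟨g, hg, hhg, hgu⟩ : ∃ g, IsExtremal (fun s : S => slack s.1) g ∧
        (∀ i : S, slack i.1 h' = 0 → slack i.1 g = 0) ∧ ∀ t : ℝ, g ≠ t • u := by
      by_contra! hcon
      obtain ⟨t, ht⟩ := hind (fun f => ∃ t : ℝ, f = t • u) ⟨0, by simp⟩
        (by rintro _ _ ⟨s, rfl⟩ ⟨t, rfl⟩; exact ⟨s + t, (add_smul s t u).symm⟩)
        h' (fun i => hh'0 _ (hSQ i.2)) hcon
      have : t = 0 := by
        have := hh'l
        rw [ht] at this
        simpa [hul] using this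
      rw [this, zero_smul] at ht
      exact hh0 (by rw [hh', ht]; rfl)
    have hhgQ : ∀ x ∈ Q, slack x h' = 0 → slack x g = 0 := fun x hx =>
      slack_eq_zero_of_mem_convexHull (fun y hy => hh'0 y (hSQ hy)) (fun y hy => hhg ⟨y, hy⟩) hx
    set k := g - (g.1 (Fin.last d) / u.1 (Fin.last d)) • u with hk
    have hkl : k.1 (Fin.last d) = 0 := by simp [hk, hul]
    have hkU : ∀ y ∈ U, slack (projFun d y) (fun i => k.1 i.castSucc, k.2) = slack y g := by
      intro y hy
      rw [slack_projFun y hkl, hk, map_sub, map_smul, hy.2, smul_zero, sub_zero]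
    obtain ⟨μ, hμ⟩ := hHspan (fun i => k.1 i.castSucc, k.2) fun x hx => by
      rw [hhH] at hx
      obtain ⟨⟨x, hxQ, rfl⟩, hx0⟩ := hx
      obtain ⟨y, hyU, hyx⟩ := hlift x hxQ
      rw [← hyx] at hx0 ⊢
      rw [hkU y hyU]
      exact hhgQ y hyU.1 ((hslack y).symm.trans hx0)
    have hμ0 : μ ≠ 0 := by
      rintro rfl
      rw [zero_smul, Prod.mk_eq_zero] at hμ
      refine hgu _ (sub_eq_zero.1 (?_ : k = 0))
      refine Prod.ext (funext fun i => ?_) hμ.2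
      induction i using Fin.lastCases with
      | last => exact hkl
      | cast i => exact congrFun hμ.1 i
    have hzero : ∀ y ∈ U, (slack y g = 0 ↔ slack (projFun d y) h = 0) := fun y hy => by
      rw [← hkU y hy, hμ, map_smul, smul_eq_zero, or_iff_right hμ0]
    refine ⟨{x ∈ Q | slack x g = 0}, ⟨hg.isFacetOf hdQ', fun hGU => ?_⟩, ?_⟩
    · obtain ⟨t, ht⟩ := hUspan g fun x hx => by
        rw [← Set.mem_singleton_iff.1 hGU] at hx
        exact hx.2
      exact hgu t ht
    · ext p
      constructor
      · rintro ⟨y, ⟨hyG, hyU⟩, rfl⟩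
        rw [hhH]
        exact ⟨⟨y, hyU.1, rfl⟩, (hzero y hyU).1 hyG.2⟩
      · intro hp
        rw [hhH] at hp
        obtain ⟨⟨x, hxQ, rfl⟩, hx0⟩ := hp
        obtain ⟨y, hyU, hyx⟩ := hlift x hxQ
        rw [← hyx] at hx0
        exact ⟨y, ⟨⟨hyU.1, (hzero y hyU).2 hx0⟩, hyU⟩, hyx⟩
  have h1 := Set.ncard_le_ncard hsub ((hfin.sdiff).image _)
  have h2 := Set.ncard_image_le (f := fun G => projFun d '' (G ∩ U)) (hfin.sdiff (t := {U}))
  have h3 := Set.ncard_sdiff_singleton_lt_of_mem (s := {F | IsFacetOf F Q}) hUfac hfin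
  unfold facetCount at hle
  omega

theorem minimal_extension_two_upper_two_lower (d : ℕ)
    (P : Set (Fin d → ℝ)) (Q : Set (Fin (d + 1) → ℝ))
    (hP : IsPolytope P) (hdP : pdim P = d)
    (hQ : IsPolytope Q) (hdQ : pdim Q = d + 1)
    (hproj : projFun d '' Q = P) (hmin : facetCount Q = xc P) :
    2 ≤ {F : Set (Fin (d + 1) → ℝ) | IsUpperFacet F Q}.ncard ∧
    2 ≤ {F : Set (Fin (d + 1) → ℝ) | IsLowerFacet F Q}.ncard := by
  have hle : facetCount Q ≤ facetCount P := hmin.trans_le <|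
    Nat.sInf_le ⟨d, P, AffineMap.id ℝ (Fin d → ℝ), hP, by simp, rfl⟩
  subst hproj
  constructor
  · simpa [IsUpperFacet] using two_le_ncard_of_facetCount_le hQ hdQ hdP hle one_ne_zero
  · simpa [IsLowerFacet] using
      two_le_ncard_of_facetCount_le hQ hdQ hdP hle (neg_ne_zero.2 one_ne_zero)

end
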